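/- arXiv:1603.03604 — 10 statements merged into one kernel-verified Lean document; each statement's English description precedes it below -/
import Mathlib

section
/- Let p be a prime, let s ≥ 1 be an integer, and set n = sp+1. Then 4 times the number of Fermat-admissible pairs for n and p equals s(s−1)p(p+1). (Equivalently, the rank of the Cartier operator on the Fermat curve F_{sp+1} is s(s−1)p(p+1)/4.) -/
/-- A pair `(i, j)` is *Fermat-admissible* for `n` and `p` if there exist integers
`h, k` with `0 ≤ h ≤ p - 1` and `0 ≤ k ≤ h` such that `n*(p-1-h) + i ≡ p-1 (mod p)`
and `n*k + j ≡ p-1 (mod p)`. -/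
def FermatAdmissible (n p i j : ℕ) : Prop :=
  ∃ h k : ℕ, h ≤ p - 1 ∧ k ≤ h ∧
    n * (p - 1 - h) + i ≡ p - 1 [MOD p] ∧ n * k + j ≡ p - 1 [MOD p]

/-- The pairs of natural numbers whose sum is less than `m`. -/
def sumLT (m : ℕ) : Finset (ℕ × ℕ) :=
  (Finset.range m).biUnion Finset.HasAntidiagonal.antidiagonal

theorem mem_sumLT {m : ℕ} {x : ℕ × ℕ} : x ∈ sumLT m ↔ x.1 + x.2 < m := by
  simp [sumLT]

theorem two_mul_card_sumLT (m : ℕ) : 2 * (sumLT m).card = m * (m + 1) := by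
  have h : (sumLT m).card = ∑ k ∈ Finset.range m, (k + 1) := by
    rw [sumLT, Finset.card_biUnion]
    · simp
    · intro a _ b _ hab
      refine Finset.disjoint_left.2 fun x hx hx' => hab ?_
      simp_all
  rw [h]
  clear h
  induction m with
  | zero => simp
  | succ m ih => rw [Finset.sum_range_succ, mul_add, ih]; ring

/-- When `n ≡ 1 (mod p)`, admissibility is a condition on the last base-`p` digits. -/
theorem fermatAdmissible_iff {p n : ℕ} (hp : 0 < p) (hn : n ≡ 1 [MOD p]) (i j : ℕ) :
    FermatAdmissible n p i j ↔ p - 1 ≤ i % p + j % p := by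
  have hi := Nat.mod_lt i hp
  have hj := Nat.mod_lt j hp
  have key (m x : ℕ) : n * m + x ≡ p - 1 [MOD p] ↔ m + x % p ≡ p - 1 [MOD p] := by
    have h : n * m + x ≡ m + x % p [MOD p] := by
      simpa using (hn.mul_right m).add (Nat.mod_modEq x p).symm
    exact ⟨h.symm.trans, h.trans⟩
  have digit {m r : ℕ} (hm : m < p) (hr : r < p) :
      m + r ≡ p - 1 [MOD p] ↔ m + r = p - 1 := by
    refine ⟨fun h => ?_, fun h => h ▸ rfl⟩
    rw [Nat.ModEq, Nat.mod_eq_of_lt (by omega : p - 1 < p)] at h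
    rcases lt_or_ge (m + r) p with h' | h'
    · rwa [Nat.mod_eq_of_lt h'] at h
    · rw [Nat.mod_eq_sub_mod h', Nat.mod_eq_of_lt (by omega)] at h
      omega
  simp only [FermatAdmissible, key]
  constructor
  · rintro ⟨h, k, hh, hk, h1, h2⟩
    rw [digit (by omega) hi] at h1
    rw [digit (by omega) hj] at h2
    omega
  · intro h
    refine ⟨i % p, p - 1 - j % p, by omega, by omega, ?_, ?_⟩
    · rw [digit (by omega) hi]; omega
    · rw [digit (by omega) hj]; omega

/-- The pair with leading base-`p` parts `x.1` and last digits complementary to `x.2`. -/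
def digitPair (p : ℕ) (x : (ℕ × ℕ) × (ℕ × ℕ)) : ℕ × ℕ :=
  (p * x.1.1 + (p - 1 - x.2.1), p * x.1.2 + (p - 1 - x.2.2))

theorem mul_add_inj_of_lt {p a b r t : ℕ} (hr : r < p) (ht : t < p)
    (h : p * a + r = p * b + t) : a = b ∧ r = t := by
  have hp : 0 < p := by omega
  have h1 := congrArg (· / p) h
  have h2 := congrArg (· % p) h
  simpa [Nat.mul_add_div hp, Nat.mul_add_mod, Nat.div_eq_of_lt, Nat.mod_eq_of_lt, hr, ht]
    using And.intro h1 h2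

theorem digitPair_injOn (p : ℕ) (A : Finset (ℕ × ℕ)) :
    Set.InjOn (digitPair p) (A ×ˢ sumLT p : Finset ((ℕ × ℕ) × (ℕ × ℕ))) := by
  rintro ⟨⟨a, b⟩, r, t⟩ hx ⟨⟨a', b'⟩, r', t'⟩ hy h
  simp only [Finset.mem_coe, Finset.mem_product, mem_sumLT] at hx hy
  simp only [digitPair, Prod.mk.injEq] at h ⊢
  have h1 := mul_add_inj_of_lt (by omega) (by omega) h.1
  have h2 := mul_add_inj_of_lt (by omega) (by omega) h.2
  omega

theorem setOf_fermatAdmissible_eq_image {p s : ℕ} (hp : 0 < p) :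
    {ij : ℕ × ℕ | (ij.1 : ℤ) + ij.2 ≤ ((s * p + 1 : ℕ) : ℤ) - 3 ∧
        FermatAdmissible (s * p + 1) p ij.1 ij.2} =
      ((sumLT (s - 1) ×ˢ sumLT p).image (digitPair p) : Finset (ℕ × ℕ)) := by
  have hn : s * p + 1 ≡ 1 [MOD p] := by simp [Nat.ModEq]
  ext ⟨i, j⟩
  simp only [Set.mem_ofPred_eq, fermatAdmissible_iff hp hn, Finset.coe_image, Set.mem_image,
    Finset.mem_coe, Finset.mem_product, mem_sumLT]
  constructor
  · rintro ⟨h1, h2⟩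
    have hi := Nat.mod_lt i hp
    have hj := Nat.mod_lt j hp
    have ei := Nat.div_add_mod i p
    have ej := Nat.div_add_mod j p
    refine ⟨((i / p, j / p), (p - 1 - i % p, p - 1 - j % p)), ⟨?_, by dsimp only; omega⟩, ?_⟩
    · have h3 : (i / p + j / p + 1) * p < s * p := by
        have : (i / p + j / p + 1) * p = p * (i / p) + p * (j / p) + p := by ring
        have h1' : i + j + 2 ≤ s * p := by
          zify
          push_cast at h1
          linarith
        omega
      have := lt_of_mul_lt_mul_right h3 (Nat.zero_le p)
      dsimp only
      omega
    · simp only [digitPair, Prod.mk.injEq]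
      omega
  · rintro ⟨⟨⟨a, b⟩, r, t⟩, ⟨hab, hrt⟩, h⟩
    simp only [digitPair, Prod.mk.injEq] at hab hrt h
    obtain ⟨rfl, rfl⟩ := h
    refine ⟨?_, ?_⟩
    · have h3 : (a + b + 2) * p ≤ s * p := Nat.mul_le_mul_right p (by omega)
      have : (a + b + 2) * p = p * a + p * b + 2 * p := by ring
      have h4 : p * a + (p - 1 - r) + (p * b + (p - 1 - t)) + 2 ≤ s * p := by omega
      zify at h4
      push_cast
      linarith
    · rw [Nat.mul_add_mod, Nat.mul_add_mod, Nat.mod_eq_of_lt (by omega),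
        Nat.mod_eq_of_lt (by omega)]
      omega

/-- The rank of the Cartier operator on the Fermat curve `F_{sp+1}` is
`s*(s-1)*p*(p+1)/4`. -/
theorem four_mul_card_fermatAdmissible_sp_add_one
    (p s n : ℕ) (hp : p.Prime) (hs : 1 ≤ s) (hn : n = s * p + 1) :
    4 * {ij : ℕ × ℕ | (ij.1 : ℤ) + ij.2 ≤ (n : ℤ) - 3 ∧
          FermatAdmissible n p ij.1 ij.2}.ncard
      = s * (s - 1) * p * (p + 1) := by
  subst hn
  rw [setOf_fermatAdmissible_eq_image hp.pos, Set.ncard_coe_finset,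
    Finset.card_image_of_injOn (digitPair_injOn p _), Finset.card_product]
  have h1 := two_mul_card_sumLT (s - 1)
  have h2 := two_mul_card_sumLT p
  rw [Nat.sub_add_cancel hs] at h1
  calc 4 * ((sumLT (s - 1)).card * (sumLT p).card)
      = (2 * (sumLT (s - 1)).card) * (2 * (sumLT p).card) := by ring
    _ = s * (s - 1) * p * (p + 1) := by rw [h1, h2]; ring
end

section
/- Let p be a prime, let s ≥ 1 be an integer, and set n = sp+1. Then 4 times the number of pairs (i,j) of nonnegative integers with i+j ≤ n−3 that are not Fermat-admissible for n and p equals s(s+1)p(p−1). (Equivalently, the a-number of the Fermat curve F_{sp+1} is a(F_{sp+1}) = s(s+1)p(p−1)/4.) -/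
/-- When `n ≡ 1 (mod p)`, admissibility only depends on the residues of `i` and `j`. -/
theorem fermatAdmissible_iff_of_modEq_one {n p i j : ℕ} (hp : 0 < p) (hn : n ≡ 1 [MOD p]) :
    FermatAdmissible n p i j ↔ p - 1 ≤ i % p + j % p := by
  have hi := Nat.mod_lt i hp
  have hj := Nat.mod_lt j hp
  have key (a c : ℕ) : n * a + c ≡ a + c % p [MOD p] := by
    simpa using (hn.mul_right a).add (Nat.mod_modEq c p).symm
  constructor
  · rintro ⟨h, k, hh, hk, h₁, h₂⟩
    have e₁ : p - 1 - h + i % p ≡ p - 1 - h + h [MOD p] := by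
      rw [Nat.sub_add_cancel hh]
      exact (key _ _).symm.trans h₁
    have e₂ : k + j % p ≡ k + (p - 1 - k) [MOD p] := by
      rw [Nat.add_sub_cancel' (hk.trans hh)]
      exact (key _ _).symm.trans h₂
    have e₃ := e₁.add_left_cancel'.eq_of_lt_of_lt hi (by omega)
    have e₄ := e₂.add_left_cancel'.eq_of_lt_of_lt hj (by omega)
    omega
  · intro h
    refine ⟨i % p, p - 1 - j % p, by omega, by omega, (key _ _).trans ?_, (key _ _).trans ?_⟩
    · rw [Nat.sub_add_cancel (by omega)]
    · rw [Nat.sub_add_cancel (by omega)]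

/-- The pairs of natural numbers with sum less than `m`. -/
def pairsSumLT (m : ℕ) : Finset (ℕ × ℕ) :=
  (Finset.range m).biUnion Finset.HasAntidiagonal.antidiagonal

theorem mem_pairsSumLT {m : ℕ} {x : ℕ × ℕ} : x ∈ pairsSumLT m ↔ x.1 + x.2 < m := by
  simp [pairsSumLT]

theorem two_mul_card_pairsSumLT (m : ℕ) : 2 * (pairsSumLT m).card = m * (m + 1) := by
  have h : (pairsSumLT m).card = ∑ k ∈ Finset.range m, (k + 1) := by
    rw [pairsSumLT, Finset.card_biUnion]
    · simp
    · intro a _ b _ hab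
      exact Finset.disjoint_left.2 fun x hx hx' ↦
        hab ((Finset.HasAntidiagonal.mem_antidiagonal.1 hx).symm.trans (Finset.HasAntidiagonal.mem_antidiagonal.1 hx'))
  rw [h]
  clear h
  induction m with
  | zero => simp
  | succ m ih => rw [Finset.sum_range_succ, mul_add, ih]; ring

/-- The `a`-number of the Fermat curve `F_{sp+1}` is `s*(s+1)*p*(p-1)/4`. -/
theorem four_mul_card_not_fermatAdmissible_sp_add_one
    (p s n : ℕ) (hp : p.Prime) (hs : 1 ≤ s) (hn : n = s * p + 1) :
    4 * {ij : ℕ × ℕ | (ij.1 : ℤ) + ij.2 ≤ (n : ℤ) - 3 ∧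
          ¬ FermatAdmissible n p ij.1 ij.2}.ncard
      = s * (s + 1) * p * (p - 1) := by
  subst hn
  have hp₂ := hp.two_le
  have hmod : s * p + 1 ≡ 1 [MOD p] := by simp [Nat.ModEq]
  have hcard : {ij : ℕ × ℕ | (ij.1 : ℤ) + ij.2 ≤ ((s * p + 1 : ℕ) : ℤ) - 3 ∧
      ¬ FermatAdmissible (s * p + 1) p ij.1 ij.2}.ncard
      = (pairsSumLT s ×ˢ pairsSumLT (p - 1)).card := by
    rw [← Set.ncard_coe_finset]
    refine Set.ncard_congr
      (fun x _ ↦ ((x.1 / p, x.2 / p), (x.1 % p, x.2 % p))) ?_ ?_ ?_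
    · rintro ⟨i, j⟩ ⟨h₁, h₂⟩
      rw [fermatAdmissible_iff_of_modEq_one hp.pos hmod] at h₂
      simp only [Finset.coe_product, Set.mem_prod, Finset.mem_coe, mem_pairsSumLT]
      refine ⟨?_, by dsimp only at h₂ ⊢; omega⟩
      have hi := Nat.div_add_mod i p
      have hj := Nat.div_add_mod j p
      have hlt : p * (i / p + j / p) < p * s := by
        rw [mul_add, mul_comm p s]
        dsimp only at h₁
        omega
      exact Nat.lt_of_mul_lt_mul_left hlt
    · rintro ⟨i, j⟩ ⟨i', j'⟩ _ _ h
      simp only [Prod.mk.injEq] at h ⊢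
      obtain ⟨⟨h₁, h₂⟩, h₃, h₄⟩ := h
      exact ⟨by rw [← Nat.div_add_mod i p, h₁, h₃, Nat.div_add_mod],
        by rw [← Nat.div_add_mod j p, h₂, h₄, Nat.div_add_mod]⟩
    · rintro ⟨⟨u, v⟩, a, b⟩ h
      simp only [Finset.coe_product, Set.mem_prod, Finset.mem_coe, mem_pairsSumLT] at h
      obtain ⟨huv, hab⟩ := h
      have ha : a < p := by omega
      have hb : b < p := by omega
      have hle : p * (u + v + 1) ≤ p * s := Nat.mul_le_mul_left p huv
      refine ⟨(p * u + a, p * v + b), ⟨?_, ?_⟩, ?_⟩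
      · rw [mul_add, mul_add, mul_comm p s] at hle
        dsimp only
        omega
      · rw [fermatAdmissible_iff_of_modEq_one hp.pos hmod]
        simp only [Nat.mul_add_mod, Nat.mod_eq_of_lt ha, Nat.mod_eq_of_lt hb]
        omega
      · simp [Nat.mul_add_div hp.pos, Nat.div_eq_of_lt, Nat.mod_eq_of_lt, ha, hb]
  rw [hcard, Finset.card_product]
  have h₁ := two_mul_card_pairsSumLT s
  have h₂ := two_mul_card_pairsSumLT (p - 1)
  rw [Nat.sub_add_cancel hp.one_le] at h₂
  calc 4 * ((pairsSumLT s).card * (pairsSumLT (p - 1)).card)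
      = (2 * (pairsSumLT s).card) * (2 * (pairsSumLT (p - 1)).card) := by ring
    _ = s * (s + 1) * p * (p - 1) := by rw [h₁, h₂]; ring
end

section
/- Let p be a prime and set n = p+1. Then there is no pair (i,j) of nonnegative integers with i+j ≤ p−2 that is Fermat-admissible for n and p; that is, there exist no nonnegative integers i, j, h, k with i+j ≤ p−2, h ≤ p−1, k ≤ h, (p+1)(p−1−h)+i ≡ p−1 (mod p) and (p+1)k+j ≡ p−1 (mod p). (Equivalently, the rank of the Cartier operator on the Hermitian curve F_{p+1} is 0, so F_{p+1} is superspecial.) -/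
/-- There is no Fermat-admissible pair for `n = p + 1`: the rank of the Cartier
operator on the Hermitian curve `F_{p+1}` is `0`, so `F_{p+1}` is superspecial. -/
theorem not_fermatAdmissible_p_add_one (p : ℕ) (hp : p.Prime) :
    ¬ ∃ i j : ℕ, i + j ≤ p - 2 ∧ FermatAdmissible (p + 1) p i j := by
  rintro ⟨i, j, hij, h, k, hh, hk, h₁, h₂⟩
  have hp2 := hp.two_le
  have succ_mul_add_modEq (m r : ℕ) : (p + 1) * m + r ≡ m + r [MOD p] := by
    rw [add_mul, one_mul, add_assoc]
    exact Nat.ModEq.modulus_mul_add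
  have hi : i = h := by
    have h₃ : (p - 1 - h) + i ≡ (p - 1 - h) + h [MOD p] := by
      rw [Nat.sub_add_cancel hh]
      exact (succ_mul_add_modEq _ _).symm.trans h₁
    exact h₃.add_left_cancel'.eq_of_lt_of_lt (by omega) (by omega)
  have hkj : k + j = p - 1 :=
    ((succ_mul_add_modEq k j).symm.trans h₂).eq_of_lt_of_lt (by omega) (by omega)
  omega
end

section
/- Let p be a prime and set n = 2p−1. Then 2 times the number of Fermat-admissible pairs for n and p equals (p−2)(p−3) + 2p(p−2). (Equivalently, the rank of the Cartier operator on the Fermat curve F_{2p−1} is (p−2)(p−3)/2 + p(p−2).) -/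
/-- Modulo `p` we have `2p - 1 ≡ -1`, so the congruence determines the residue `m`. -/
theorem two_mul_sub_one_mul_add_modEq_iff {p m : ℕ} (j : ℕ) (hm : m < p) :
    (2 * p - 1) * m + j ≡ p - 1 [MOD p] ↔ m = (j + 1) % p := by
  have hsum : (2 * p - 1) * m + j + 1 + m = p * (2 * m) + (j + 1) := by
    obtain ⟨q, rfl⟩ : ∃ q, p = q + 1 := ⟨p - 1, by omega⟩
    rw [show 2 * (q + 1) - 1 = 2 * q + 1 by omega]
    ring
  calc (2 * p - 1) * m + j ≡ p - 1 [MOD p]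
      ↔ (2 * p - 1) * m + j + 1 + m ≡ p - 1 + 1 + m [MOD p] :=
        ⟨fun h ↦ (h.add_right 1).add_right m,
          fun h ↦ (h.add_right_cancel' m).add_right_cancel' 1⟩
    _ ↔ m = (j + 1) % p := by
        rw [hsum, show p - 1 + 1 + m = p + m by omega, Nat.ModEq, Nat.mul_add_mod,
          Nat.add_mod_left, Nat.mod_eq_of_lt hm, eq_comm]

theorem fermatAdmissible_two_mul_sub_one_iff {p : ℕ} (hp : 0 < p) (i j : ℕ) :
    FermatAdmissible (2 * p - 1) p i j ↔ (i + 1) % p + (j + 1) % p < p := by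
  have hi := Nat.mod_lt (i + 1) hp
  constructor
  · rintro ⟨h, k, hh, hk, h₁, h₂⟩
    rw [two_mul_sub_one_mul_add_modEq_iff _ (by omega)] at h₁ h₂
    omega
  · intro hlt
    refine ⟨p - 1 - (i + 1) % p, (j + 1) % p, by omega, by omega, ?_, ?_⟩
    · rw [two_mul_sub_one_mul_add_modEq_iff _ (by omega)]
      omega
    · rw [two_mul_sub_one_mul_add_modEq_iff _ (by omega)]

/-- The pairs of natural numbers with sum less than `m`. -/
def natTriangle (m : ℕ) : Finset (ℕ × ℕ) :=
  (Finset.range m).biUnion Finset.HasAntidiagonal.antidiagonal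

theorem mem_natTriangle {m : ℕ} {x : ℕ × ℕ} : x ∈ natTriangle m ↔ x.1 + x.2 < m := by
  simp [natTriangle]

theorem two_mul_card_natTriangle (m : ℕ) : 2 * (natTriangle m).card = (m + 1) * m := by
  rw [natTriangle, Finset.card_biUnion]
  · simp_rw [Finset.Nat.card_antidiagonal]
    have h := Finset.sum_range_id_mul_two (m + 1)
    rw [Finset.sum_range_succ', add_zero, Nat.add_sub_cancel] at h
    rw [mul_comm, h]
  · intro a _ b _ hab
    exact Finset.disjoint_left.2 fun x hx hy ↦
      hab ((Finset.HasAntidiagonal.mem_antidiagonal.1 hx).symm.trans (Finset.HasAntidiagonal.mem_antidiagonal.1 hy))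

/-- The rank of the Cartier operator on the Fermat curve `F_{2p-1}` is
`(p-2)*(p-3)/2 + p*(p-2)`. -/
theorem two_mul_card_fermatAdmissible_two_p_sub_one
    (p n : ℕ) (hp : p.Prime) (hn : n = 2 * p - 1) :
    2 * {ij : ℕ × ℕ | (ij.1 : ℤ) + ij.2 ≤ (n : ℤ) - 3 ∧
          FermatAdmissible n p ij.1 ij.2}.ncard
      = (p - 2) * (p - 3) + 2 * (p * (p - 2)) := by
  subst hn
  have hp2 := hp.two_le
  let T := natTriangle (p - 2)
  let R := T.map (addRightEmbedding (p - 1, 0))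
  let U := T.map (addRightEmbedding (0, p - 1))
  have hR (x : ℕ × ℕ) : x ∈ R ↔ p - 1 ≤ x.1 ∧ x.1 - (p - 1) + x.2 < p - 2 := by
    simp only [R, T, Finset.mem_map, mem_natTriangle, addRightEmbedding_apply]
    constructor
    · rintro ⟨y, hy, rfl⟩
      simp only [Prod.fst_add, Prod.snd_add]
      omega
    · rintro ⟨h₁, h₂⟩
      exact ⟨(x.1 - (p - 1), x.2), h₂, Prod.ext (Nat.sub_add_cancel h₁) rfl⟩
  have hU (x : ℕ × ℕ) : x ∈ U ↔ p - 1 ≤ x.2 ∧ x.1 + (x.2 - (p - 1)) < p - 2 := by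
    simp only [U, T, Finset.mem_map, mem_natTriangle, addRightEmbedding_apply]
    constructor
    · rintro ⟨y, hy, rfl⟩
      simp only [Prod.fst_add, Prod.snd_add]
      omega
    · rintro ⟨h₁, h₂⟩
      exact ⟨(x.1, x.2 - (p - 1)), h₂, Prod.ext rfl (Nat.sub_add_cancel h₁)⟩
  have hset : {ij : ℕ × ℕ | (ij.1 : ℤ) + ij.2 ≤ ((2 * p - 1 : ℕ) : ℤ) - 3 ∧
      FermatAdmissible (2 * p - 1) p ij.1 ij.2} = ((T ∪ R) ∪ U : Finset (ℕ × ℕ)) := by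
    have hmod (a : ℕ) (ha : a + 1 < 2 * p) :
        (a + 1) % p = if a + 1 < p then a + 1 else a + 1 - p := by
      split_ifs with h
      · exact Nat.mod_eq_of_lt h
      · rw [Nat.mod_eq_sub_mod (by omega), Nat.mod_eq_of_lt (by omega)]
    ext x
    simp only [Set.mem_ofPred_eq, Finset.mem_coe, Finset.mem_union, hR, hU, T, mem_natTriangle,
      fermatAdmissible_two_mul_sub_one_iff hp.pos]
    by_cases hx : x.1 + x.2 + 4 ≤ 2 * p
    · rw [hmod x.1 (by omega), hmod x.2 (by omega)]
      split_ifs <;> omega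
    · omega
  have hTR : Disjoint T R := Finset.disjoint_left.2 fun x hx hy ↦ by
    rw [mem_natTriangle] at hx
    rw [hR] at hy
    omega
  have hTRU : Disjoint (T ∪ R) U := Finset.disjoint_left.2 fun x hx hy ↦ by
    rw [Finset.mem_union, mem_natTriangle, hR] at hx
    rw [hU] at hy
    omega
  rw [hset, Set.ncard_coe_finset, Finset.card_union_of_disjoint hTRU,
    Finset.card_union_of_disjoint hTR, Finset.card_map, Finset.card_map]
  have hT := two_mul_card_natTriangle (p - 2)
  rw [show 2 * (T.card + T.card + T.card) = 3 * (2 * T.card) by ring, hT]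
  obtain rfl | hp3 := hp2.eq_or_lt
  · rfl
  · obtain ⟨q, rfl⟩ : ∃ q, p = q + 3 := ⟨p - 3, by omega⟩
    rw [show q + 3 - 2 = q + 1 by omega, Nat.add_sub_cancel]
    ring
end

section
/- Let p be a prime and set n = 3p−1. Then the number of Fermat-admissible pairs for n and p equals 3(p−1)². (Equivalently, the rank of the Cartier operator on the Fermat curve F_{3p−1} is 3(p−1)².) -/
theorem fermatAdmissible_three_mul_sub_one_iff (q i j : ℕ) :
    FermatAdmissible (3 * (q + 2) - 1) (q + 2) i j ↔
      (i % (q + 2) = q + 1 ∨ j % (q + 2) = q + 1 ∨ i % (q + 2) + j % (q + 2) < q) := by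
  have hmod : ∀ a b : ℕ, a ≡ b [MOD q + 2] ↔ (a : ZMod (q + 2)) = b := fun a b =>
    (ZMod.natCast_eq_natCast_iff a b (q + 2)).symm
  have hq : (q : ZMod (q + 2)) + 2 = 0 := by exact_mod_cast ZMod.natCast_self (q + 2)
  have hn : ((3 * (q + 2) - 1 : ℕ) : ZMod (q + 2)) = -1 := by
    rw [show 3 * (q + 2) - 1 = 3 * q + 5 by omega]
    push_cast
    linear_combination 3 * hq
  have left (h : ℕ) (hh : h ≤ q + 1) :
      (3 * (q + 2) - 1) * (q + 2 - 1 - h) + i ≡ q + 2 - 1 [MOD q + 2] ↔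
        h + i + 2 ≡ 0 [MOD q + 2] := by
    rw [hmod, hmod, show q + 2 - 1 = q + 1 from rfl]
    push_cast [hn, Nat.cast_sub hh]
    constructor <;> intro H
    · linear_combination H + 2 * hq
    · linear_combination H - 2 * hq
  have right (k : ℕ) :
      (3 * (q + 2) - 1) * k + j ≡ q + 2 - 1 [MOD q + 2] ↔ k ≡ j + 1 [MOD q + 2] := by
    rw [hmod, hmod, show q + 2 - 1 = q + 1 from rfl]
    push_cast [hn]
    constructor <;> intro H
    · linear_combination -H - hq
    · linear_combination -H - hq
  have left' (h : ℕ) (hh : h ≤ q + 1) : h + i + 2 ≡ 0 [MOD q + 2] ↔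
      h + i % (q + 2) = q ∨ h + i % (q + 2) = 2 * q + 2 := by
    have hi := Nat.mod_lt i (show 0 < q + 2 by omega)
    have hcongr : h + i + 2 ≡ h + i % (q + 2) + 2 [MOD q + 2] :=
      ((Nat.mod_modEq i (q + 2)).symm.add_left h).add_right 2
    rw [show h + i + 2 ≡ 0 [MOD q + 2] ↔ h + i % (q + 2) + 2 ≡ 0 [MOD q + 2] from
      ⟨hcongr.symm.trans, hcongr.trans⟩, Nat.modEq_zero_iff_dvd]
    constructor
    · rintro ⟨c, hc⟩
      have : c < 3 := by
        by_contra! h3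
        have := Nat.mul_le_mul_left (q + 2) h3
        omega
      interval_cases c <;> omega
    · rintro (H | H)
      · exact ⟨1, by omega⟩
      · exact ⟨2, by omega⟩
  have right' (k : ℕ) (hk : k ≤ q + 1) : k ≡ j + 1 [MOD q + 2] ↔
      k = j % (q + 2) + 1 ∨ (k = 0 ∧ j % (q + 2) = q + 1) := by
    have hj := Nat.mod_lt j (show 0 < q + 2 by omega)
    have hcongr : j + 1 ≡ j % (q + 2) + 1 [MOD q + 2] := (Nat.mod_modEq j (q + 2)).symm.add_right 1
    rw [show k ≡ j + 1 [MOD q + 2] ↔ k ≡ j % (q + 2) + 1 [MOD q + 2] from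
      ⟨fun H => H.trans hcongr, fun H => H.trans hcongr.symm⟩, Nat.ModEq,
      Nat.mod_eq_of_lt (show k < q + 2 by omega)]
    rcases Nat.lt_or_ge (j % (q + 2)) (q + 1) with H | H
    · rw [Nat.mod_eq_of_lt (show j % (q + 2) + 1 < q + 2 by omega)]
      omega
    · rw [show j % (q + 2) + 1 = q + 2 by omega, Nat.mod_self]
      omega
  have hi := Nat.mod_lt i (show 0 < q + 2 by omega)
  have hj := Nat.mod_lt j (show 0 < q + 2 by omega)
  constructor
  · rintro ⟨h, k, hh, hk, h1, h2⟩
    rw [left h hh, left' h hh] at h1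
    rw [right, right' k (by omega)] at h2
    omega
  · intro H
    refine ⟨if i % (q + 2) = q + 1 then q + 1 else q - i % (q + 2),
      if j % (q + 2) = q + 1 then 0 else j % (q + 2) + 1, ?_, ?_, ?_, ?_⟩
    · split_ifs <;> omega
    · split_ifs <;> omega
    · rw [left _ (by split_ifs <;> omega), left' _ (by split_ifs <;> omega)]
      split_ifs <;> omega
    · rw [right, right' _ (by split_ifs <;> omega)]
      split_ifs <;> omega

/-- The admissible residue pairs in a `(q + 2) × (q + 2)` block on the `c`-th block antidiagonal. -/
def admissibleBlock (q c : ℕ) : Finset (ℕ × ℕ) :=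
  (Finset.range (q + 2) ×ˢ Finset.range (q + 2)).filter fun ab =>
    (ab.1 = q + 1 ∨ ab.2 = q + 1 ∨ ab.1 + ab.2 < q) ∧ ab.1 + ab.2 + (q + 2) * c ≤ 3 * q + 2

theorem card_admissibleBlock (q c : ℕ) :
    (admissibleBlock q c).card = ∑ a ∈ Finset.range (q + 2),
      ((Finset.range (q + 2)).filter fun b =>
        (a = q + 1 ∨ b = q + 1 ∨ a + b < q) ∧ a + b + (q + 2) * c ≤ 3 * q + 2).card := by
  simp only [admissibleBlock, Finset.card_filter, Finset.sum_product]

theorem sum_range_sub_mul_two (m : ℕ) :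
    (∑ a ∈ Finset.range m, (m - a)) * 2 = m * (m + 1) := by
  rw [← Finset.sum_range_reflect, Finset.sum_congr rfl (g := fun a => a + 1),
    Finset.sum_add_distrib, add_mul,
    Finset.sum_range_id_mul_two]
  · cases m <;> simp; ring
  · intro a ha
    have := Finset.mem_range.1 ha
    omega

theorem card_admissibleBlock_zero (q : ℕ) :
    (admissibleBlock q 0).card * 2 = q * (q + 1) + 4 * q + 6 := by
  rw [card_admissibleBlock, Finset.sum_range_succ,
    Finset.sum_congr rfl (g := fun a => (q + 1 - a)), add_mul, sum_range_sub_mul_two,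
    show (Finset.range (q + 2)).filter _ = Finset.range (q + 2) by
      ext b; simp; omega]
  · simp; ring
  · intro a ha
    have := Finset.mem_range.1 ha
    rw [show (Finset.range (q + 2)).filter _ = insert (q + 1) (Finset.range (q - a)) by
      ext b; simp; omega, Finset.card_insert_of_notMem (by simp; omega), Finset.card_range]
    omega

theorem card_admissibleBlock_one (q : ℕ) :
    (admissibleBlock q 1).card * 2 = q * (q + 1) + 4 * q := by
  rw [card_admissibleBlock, Finset.sum_range_succ, Finset.sum_range_succ,
    Finset.sum_congr rfl (g := fun a => (q - a) + 1), Finset.sum_add_distrib, add_mul, add_mul,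
    add_mul, sum_range_sub_mul_two,
    show (Finset.range (q + 2)).filter (fun b =>
      (q = q + 1 ∨ b = q + 1 ∨ q + b < q) ∧ q + b + (q + 2) * 1 ≤ 3 * q + 2) = ∅ by
      ext b; simp; omega,
    show (Finset.range (q + 2)).filter _ = Finset.range q by
      ext b; simp; omega]
  · simp; ring
  · intro a ha
    have := Finset.mem_range.1 ha
    rw [show (Finset.range (q + 2)).filter _ = insert (q + 1) (Finset.range (q - a)) by
      ext b; simp; omega, Finset.card_insert_of_notMem (by simp; omega), Finset.card_range]

theorem card_admissibleBlock_two (q : ℕ) :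
    (admissibleBlock q 2).card * 2 = q * (q - 1) := by
  rw [card_admissibleBlock,
    Finset.sum_congr rfl (g := fun a => q - 1 - a)]
  · rw [← Finset.sum_subset (Finset.range_mono (show q - 1 ≤ q + 2 by omega)),
      sum_range_sub_mul_two]
    · cases q <;> simp; ring
    · intro a _ ha
      simp at ha ⊢; omega
  · intro a ha
    have := Finset.mem_range.1 ha
    rw [show (Finset.range (q + 2)).filter _ = Finset.range (q - 1 - a) by
      ext b; simp; omega, Finset.card_range]

theorem admissibleBlock_eq_empty (q c : ℕ) (hc : 3 ≤ c) : admissibleBlock q c = ∅ := by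
  ext ⟨a, b⟩
  have : (q + 2) * 3 ≤ (q + 2) * c := Nat.mul_le_mul_left _ hc
  simp [admissibleBlock]
  omega

/-- The Fermat-admissible pairs for `n = 3 * (q + 2) - 1` and modulus `q + 2`. -/
def admissiblePairs (q : ℕ) : Finset (ℕ × ℕ) :=
  (Finset.range (3 * (q + 2)) ×ˢ Finset.range (3 * (q + 2))).filter fun ij =>
    (ij.1 % (q + 2) = q + 1 ∨ ij.2 % (q + 2) = q + 1 ∨ ij.1 % (q + 2) + ij.2 % (q + 2) < q) ∧
      ij.1 + ij.2 ≤ 3 * q + 2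

theorem card_admissiblePairs_fiber (q u v : ℕ) :
    ((admissiblePairs q).filter fun ij => (ij.1 / (q + 2), ij.2 / (q + 2)) = (u, v)).card =
      (admissibleBlock q (u + v)).card := by
  refine Finset.card_nbij' (fun ij => (ij.1 % (q + 2), ij.2 % (q + 2)))
    (fun ab => (ab.1 + (q + 2) * u, ab.2 + (q + 2) * v)) ?_ ?_ ?_ ?_
  · rintro ⟨i, j⟩ h
    simp only [admissiblePairs, admissibleBlock, Finset.coe_filter, Set.mem_ofPred_eq,
      Finset.mem_filter, Finset.mem_product, Finset.mem_range, Prod.mk.injEq] at h ⊢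
    obtain ⟨⟨-, hA, hle⟩, rfl, rfl⟩ := h
    have hi := Nat.div_add_mod i (q + 2)
    have hj := Nat.div_add_mod j (q + 2)
    refine ⟨⟨Nat.mod_lt _ (by omega), Nat.mod_lt _ (by omega)⟩, hA, ?_⟩
    rw [mul_add]
    omega
  · rintro ⟨a, b⟩ h
    simp only [admissiblePairs, admissibleBlock, Finset.coe_filter, Set.mem_ofPred_eq,
      Finset.mem_filter, Finset.mem_product, Finset.mem_range, Prod.mk.injEq] at h ⊢
    obtain ⟨⟨ha, hb⟩, hA, hle⟩ := h
    rw [mul_add] at hle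
    simp only [Nat.add_mul_mod_self_left, Nat.mod_eq_of_lt ha, Nat.mod_eq_of_lt hb,
      Nat.add_mul_div_left _ _ (show 0 < q + 2 by omega), Nat.div_eq_of_lt ha,
      Nat.div_eq_of_lt hb, zero_add, and_self, and_true]
    exact ⟨by omega, hA, by omega⟩
  · rintro ⟨i, j⟩ h
    simp only [Finset.coe_filter, Set.mem_ofPred_eq, Prod.mk.injEq] at h
    obtain ⟨-, rfl, rfl⟩ := h
    simp [Nat.mod_add_div]
  · rintro ⟨a, b⟩ h
    simp only [admissibleBlock, Finset.coe_filter, Set.mem_ofPred_eq, Finset.mem_product,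
      Finset.mem_range] at h
    simp [Nat.mod_eq_of_lt h.1.1, Nat.mod_eq_of_lt h.1.2]

theorem card_admissiblePairs (q : ℕ) : (admissiblePairs q).card = 3 * (q + 1) ^ 2 := by
  have maps : ∀ ij ∈ admissiblePairs q,
      (ij.1 / (q + 2), ij.2 / (q + 2)) ∈ Finset.range 3 ×ˢ Finset.range 3 := by
    intro ij h
    simp only [admissiblePairs, Finset.mem_filter, Finset.mem_product, Finset.mem_range] at h ⊢
    exact ⟨Nat.div_lt_of_lt_mul (by omega), Nat.div_lt_of_lt_mul (by omega)⟩
  rw [Finset.card_eq_sum_card_fiberwise maps, Finset.sum_product]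
  simp only [card_admissiblePairs_fiber, Finset.sum_range_succ, Finset.sum_range_zero]
  norm_num [admissibleBlock_eq_empty]
  have h0 := card_admissibleBlock_zero q
  have h1 := card_admissibleBlock_one q
  have h2 := card_admissibleBlock_two q
  rcases q with _ | q
  · omega
  · simp only [Nat.add_sub_cancel] at h2
    nlinarith

/-- The rank of the Cartier operator on the Fermat curve `F_{3p-1}` is `3*(p-1)^2`. -/
theorem card_fermatAdmissible_three_p_sub_one
    (p n : ℕ) (hp : p.Prime) (hn : n = 3 * p - 1) :
    {ij : ℕ × ℕ | (ij.1 : ℤ) + ij.2 ≤ (n : ℤ) - 3 ∧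
        FermatAdmissible n p ij.1 ij.2}.ncard
      = 3 * (p - 1) ^ 2 := by
  obtain ⟨q, rfl⟩ := Nat.exists_eq_add_of_le' hp.two_le
  subst hn
  rw [show q + 2 - 1 = q + 1 from rfl, ← card_admissiblePairs, ← Set.ncard_coe_finset]
  congr 1
  ext ⟨i, j⟩
  simp only [Set.mem_ofPred_eq, fermatAdmissible_three_mul_sub_one_iff, admissiblePairs,
    Finset.coe_filter, Finset.mem_product, Finset.mem_range]
  omega
end

section
/- Let n ≥ 2 and p ≥ 2 be integers. Let i, j, i₀, j₀ be nonnegative integers with i+j ≤ n−2 and i₀+j₀ ≤ n−2, and let h, k, h₀, k₀ be nonnegative integers with h ≤ p−1, k ≤ h, h₀ ≤ p−1, k₀ ≤ h₀. If n·k − h + i = n·k₀ − h₀ + i₀ and n·(h−k) + k + j = n·(h₀−k₀) + k₀ + j₀ (as integers), then (i,j) = (i₀,j₀). (This is the injectivity of exponent pairs used to prove that the nonzero images of distinct basis differentials under the Cartier operator on the Hurwitz curve H_n are linearly independent.) -/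
/-- Injectivity of exponent pairs for the Hurwitz curve `H_n`: the monomials
`x^(nk-h+p-1+i) y^(n(h-k)+k+j)` arising from distinct pairs `(i, j)` with
`i + j ≤ n - 2` never coincide. -/
theorem hurwitz_exponents_injective (n p : ℕ) (hn : 2 ≤ n) (hp : 2 ≤ p)
    (i j i₀ j₀ h k h₀ k₀ : ℕ)
    (hij : i + j ≤ n - 2) (hij₀ : i₀ + j₀ ≤ n - 2)
    (hh : h ≤ p - 1) (hk : k ≤ h) (hh₀ : h₀ ≤ p - 1) (hk₀ : k₀ ≤ h₀)
    (e1 : (n : ℤ) * k - h + i = (n : ℤ) * k₀ - h₀ + i₀)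
    (e2 : (n : ℤ) * ((h : ℤ) - k) + k + j = (n : ℤ) * ((h₀ : ℤ) - k₀) + k₀ + j₀) :
    i = i₀ ∧ j = j₀ := by
  have hs : (i : ℤ) + j ≤ n - 2 := by omega
  have hs₀ : (i₀ : ℤ) + j₀ ≤ n - 2 := by omega
  have hn' : (2 : ℤ) ≤ n := by exact_mod_cast hn
  have weight_le (a b : ℕ) (hab : (a : ℤ) + b ≤ n - 2) : (n : ℤ) * a + b ≤ n * (n - 2) := by
    nlinarith [Int.natCast_nonneg b]
  have hw := weight_le i j hs
  have hw₀ := weight_le i₀ j₀ hs₀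
  have hpos : (0 : ℤ) ≤ n * i + j := by positivity
  have hpos₀ : (0 : ℤ) ≤ n * i₀ + j₀ := by positivity
  have hdvd : (n : ℤ) ^ 2 - n + 1 ∣ (n * i + j : ℤ) - (n * i₀ + j₀) :=
    ⟨k₀ - k, by linear_combination (n : ℤ) * e1 + e2⟩
  have hzero : (n * i + j : ℤ) - (n * i₀ + j₀) = 0 :=
    Int.eq_zero_of_abs_lt_dvd hdvd (by rw [abs_lt]; constructor <;> nlinarith)
  have hj : (j : ℤ) - j₀ = 0 :=
    Int.eq_zero_of_abs_lt_dvd (m := n) ⟨i₀ - i, by linear_combination hzero⟩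
      (by rw [abs_lt]; constructor <;> omega)
  have hi : (n : ℤ) * (i - i₀) = 0 := by linear_combination hzero - hj
  have hi' : (i : ℤ) - i₀ = 0 := (mul_eq_zero.mp hi).resolve_left (by omega)
  omega
end

section
/- Let p be a prime, let s ≥ 1 be an integer, and set n = sp. Then 4 times the number of Hurwitz-admissible pairs for n and p equals s(s−1)p(p+1). (Equivalently, the rank of the Cartier operator on the Hurwitz curve H_{sp} is s(s−1)p(p+1)/4.) -/
/-- A pair `(i, j)` is *Hurwitz-admissible* for `n` and `p` if there exist integers
`h, k` with `0 ≤ h ≤ p - 1` and `0 ≤ k ≤ h` such that `n*k - h + i ≡ 0 (mod p)`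
and `n*(h-k) + k + j ≡ p-1 (mod p)`. -/
def HurwitzAdmissible (n p i j : ℕ) : Prop :=
  ∃ h k : ℕ, h ≤ p - 1 ∧ k ≤ h ∧
    ((n : ℤ) * k - h + i ≡ 0 [ZMOD (p : ℤ)]) ∧
    ((n : ℤ) * ((h : ℤ) - k) + k + j ≡ (p : ℤ) - 1 [ZMOD (p : ℤ)])

/-- For `n = s * p` admissibility only depends on the residues of `i` and `j` modulo `p`. -/
theorem hurwitzAdmissible_mul_iff {p : ℕ} (hp : 0 < p) (s i j : ℕ) :
    HurwitzAdmissible (s * p) p i j ↔ p ≤ i % p + j % p + 1 := by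
  have hi := Nat.mod_lt i hp
  have hj := Nat.mod_lt j hp
  have hi' := Nat.mod_add_div i p
  have hj' := Nat.mod_add_div j p
  constructor
  · rintro ⟨h, k, hh, hk, h₁, h₂⟩
    have e₁ : h = i % p := by
      rw [← Nat.mod_eq_of_lt (show h < p by omega)]
      refine (Nat.modEq_iff_dvd.mpr ?_ : h ≡ i [MOD p])
      have := (Int.modEq_zero_iff_dvd.mp h₁).sub (Dvd.intro_left ((s : ℤ) * k) rfl)
      refine this.trans (dvd_of_eq ?_)
      push_cast
      ring
    have e₂ : p - 1 - k = j % p := by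
      rw [← Nat.mod_eq_of_lt (show p - 1 - k < p by omega)]
      refine (Nat.modEq_iff_dvd.mpr ?_ : p - 1 - k ≡ j [MOD p])
      have := h₂.symm.dvd.sub (Dvd.intro_left ((s : ℤ) * (h - k)) rfl)
      refine this.trans (dvd_of_eq ?_)
      rw [Nat.cast_sub (by omega), Nat.cast_sub (by omega)]
      push_cast
      ring
    omega
  · intro hij
    refine ⟨i % p, p - 1 - j % p, by omega, by omega, ?_, ?_⟩
    · refine Int.modEq_zero_iff_dvd.mpr ⟨s * (p - 1 - j % p : ℕ) + (i / p : ℕ), ?_⟩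
      have : (i : ℤ) = (i % p : ℕ) + p * (i / p : ℕ) := by exact_mod_cast hi'.symm
      push_cast at this ⊢
      linear_combination this
    · refine Int.ModEq.symm (Int.modEq_iff_dvd.mpr
        ⟨s * ((i % p : ℕ) - (p - 1 - j % p : ℕ)) + (j / p : ℕ), ?_⟩)
      have : (j : ℤ) = (j % p : ℕ) + p * (j / p : ℕ) := by exact_mod_cast hj'.symm
      rw [Nat.cast_sub (by omega), Nat.cast_sub (by omega)]
      push_cast at this ⊢
      linear_combination this

/-- The lattice points `(a, b)` of `ℕ × ℕ` with `a + b < m`. -/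
def latticeTriangle (m : ℕ) : Finset (ℕ × ℕ) :=
  (Finset.range m ×ˢ Finset.range m).filter fun x => x.1 + x.2 < m

theorem mem_latticeTriangle {m : ℕ} {x : ℕ × ℕ} : x ∈ latticeTriangle m ↔ x.1 + x.2 < m := by
  simp only [latticeTriangle, Finset.mem_filter, Finset.mem_product, Finset.mem_range]
  omega

theorem two_mul_card_latticeTriangle (m : ℕ) : 2 * (latticeTriangle m).card = m * (m + 1) := by
  have h : (latticeTriangle m).card = ∑ a ∈ Finset.range m, (m - a) := by
    rw [latticeTriangle, Finset.card_filter, Finset.sum_product]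
    refine Finset.sum_congr rfl fun a _ => ?_
    rw [← Finset.card_filter, ← Finset.card_range (m - a)]
    congr 1
    ext b
    simp only [Finset.mem_filter, Finset.mem_range]
    omega
  rw [h]
  clear h
  induction m with
  | zero => simp
  | succ m ih =>
    rw [Finset.sum_range_succ']
    simp only [Nat.add_sub_add_right, Nat.sub_zero]
    linarith

/-- If the residues of `i` and `j` modulo `p` sum to at least `p - 1`, then `i + j ≤ s * p - 2`
is a condition on the quotients alone. -/
theorem add_le_mul_sub_two_iff {p s i j : ℕ} (hp : 2 ≤ p) (hs : 1 ≤ s)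
    (hij : p ≤ i % p + j % p + 1) : i + j ≤ s * p - 2 ↔ i / p + j / p < s - 1 := by
  have hi := Nat.mod_lt i (show p > 0 by omega)
  have hj := Nat.mod_lt j (show p > 0 by omega)
  have hi' := Nat.mod_add_div i p
  have hj' := Nat.mod_add_div j p
  have hsp : p ≤ s * p := Nat.le_mul_of_pos_left p hs
  constructor
  · intro h
    by_contra! hc
    have : p * s ≤ p * (i / p + j / p + 1) := Nat.mul_le_mul_left p (by omega)
    rw [mul_add, mul_add, mul_one, mul_comm p s] at this
    omega
  · intro h
    have : p * (i / p + j / p + 2) ≤ p * s := Nat.mul_le_mul_left p (by omega)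
    rw [mul_add, mul_add, mul_comm p s] at this
    omega

/-- The rank of the Cartier operator on the Hurwitz curve `H_{sp}` is
`s*(s-1)*p*(p+1)/4`. -/
theorem four_mul_card_hurwitzAdmissible_sp
    (p s n : ℕ) (hp : p.Prime) (hs : 1 ≤ s) (hn : n = s * p) :
    4 * {ij : ℕ × ℕ | ij.1 + ij.2 ≤ n - 2 ∧
          HurwitzAdmissible n p ij.1 ij.2}.ncard
      = s * (s - 1) * p * (p + 1) := by
  subst hn
  have hp2 := hp.two_le
  have key : {ij : ℕ × ℕ | ij.1 + ij.2 ≤ s * p - 2 ∧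
      HurwitzAdmissible (s * p) p ij.1 ij.2}.ncard =
      (latticeTriangle (s - 1) ×ˢ latticeTriangle p).card := by
    rw [← Set.ncard_coe_finset]
    refine Set.ncard_congr (fun x _ => ((x.1 / p, x.2 / p), (p - 1 - x.1 % p, p - 1 - x.2 % p)))
      ?_ ?_ ?_
    · rintro ⟨i, j⟩ ⟨h₁, h₂⟩
      rw [hurwitzAdmissible_mul_iff hp.pos] at h₂
      have h₃ := (add_le_mul_sub_two_iff hp2 hs h₂).mp h₁
      simp only [Finset.mem_coe, Finset.mem_product, mem_latticeTriangle]
      dsimp only at h₂ h₃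
      refine ⟨h₃, ?_⟩
      omega
    · rintro ⟨i, j⟩ ⟨i', j'⟩ - - h
      simp only [Prod.mk.injEq] at h ⊢
      obtain ⟨⟨h₁, h₂⟩, h₃, h₄⟩ := h
      have := Nat.mod_lt i hp.pos
      have := Nat.mod_lt j hp.pos
      have := Nat.mod_lt i' hp.pos
      have := Nat.mod_lt j' hp.pos
      rw [← Nat.mod_add_div i p, ← Nat.mod_add_div j p, ← Nat.mod_add_div i' p,
        ← Nat.mod_add_div j' p, h₁, h₂]
      omega
    · rintro ⟨⟨a, c⟩, b, d⟩ h
      simp only [Finset.mem_coe, Finset.mem_product, mem_latticeTriangle] at h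
      have hb : p - 1 - b < p := by omega
      have hd : p - 1 - d < p := by omega
      have div_eq {r : ℕ} (q : ℕ) (hr : r < p) : (r + p * q) / p = q := by
        rw [Nat.add_mul_div_left _ _ hp.pos, Nat.div_eq_of_lt hr, zero_add]
      have mod_eq {r : ℕ} (q : ℕ) (hr : r < p) : (r + p * q) % p = r := by
        rw [Nat.add_mul_mod_self_left, Nat.mod_eq_of_lt hr]
      have hres : p ≤ (p - 1 - b + p * a) % p + (p - 1 - d + p * c) % p + 1 := by
        rw [mod_eq a hb, mod_eq c hd]
        omega
      refine ⟨(p - 1 - b + p * a, p - 1 - d + p * c), ⟨?_, ?_⟩, ?_⟩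
      · rw [add_le_mul_sub_two_iff hp2 hs hres, div_eq a hb, div_eq c hd]
        exact h.1
      · exact (hurwitzAdmissible_mul_iff hp.pos _ _ _).mpr hres
      · simp only [div_eq a hb, div_eq c hd, mod_eq a hb, mod_eq c hd, Prod.mk.injEq]
        exact ⟨trivial, by omega, by omega⟩
  rw [key, Finset.card_product]
  have h₁ := two_mul_card_latticeTriangle (s - 1)
  have h₂ := two_mul_card_latticeTriangle p
  rw [Nat.sub_add_cancel hs] at h₁
  calc 4 * ((latticeTriangle (s - 1)).card * (latticeTriangle p).card)
      = (2 * (latticeTriangle (s - 1)).card) * (2 * (latticeTriangle p).card) := by ring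
    _ = s * (s - 1) * p * (p + 1) := by rw [h₁, h₂]; ring
end

section
/- Let p be a prime and set n = p. Then there is no pair (i,j) of nonnegative integers with i+j ≤ p−2 that is Hurwitz-admissible for n and p; that is, there exist no nonnegative integers i, j, h, k with i+j ≤ p−2, h ≤ p−1, k ≤ h, p·k − h + i ≡ 0 (mod p) and p·(h−k) + k + j ≡ p−1 (mod p). (Equivalently, the rank of the Cartier operator on the Hurwitz curve H_p is 0, so H_p is superspecial.) -/
/-- There is no Hurwitz-admissible pair for `n = p`: the rank of the Cartier
operator on the Hurwitz curve `H_p` is `0`, so `H_p` is superspecial. -/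
theorem not_hurwitzAdmissible_p (p : ℕ) (hp : p.Prime) :
    ¬ ∃ i j : ℕ, i + j ≤ p - 2 ∧ HurwitzAdmissible p p i j := by
  rintro ⟨i, j, hij, h, k, hh, hkh, h₁, h₂⟩
  have hp2 := hp.two_le
  have hdvd₁ : (p : ℤ) ∣ (i : ℤ) - h := by
    obtain ⟨c, hc⟩ := h₁.dvd
    exact ⟨-c - k, by linear_combination -hc⟩
  have hdvd₂ : (p : ℤ) ∣ (k : ℤ) + j + 1 := by
    obtain ⟨c, hc⟩ := h₂.dvd
    exact ⟨1 - (h - k) - c, by linear_combination -hc⟩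
  have hi : (i : ℤ) - h = 0 :=
    Int.eq_zero_of_abs_lt_dvd hdvd₁ (abs_lt.mpr ⟨by omega, by omega⟩)
  have hle := Int.le_of_dvd (by omega) hdvd₂
  omega
end

section
/- Let p be a prime, let s ≥ 1 be an integer, and set n = sp+1. Then 4 times the number of Hurwitz-admissible pairs for n and p equals s(s+1)p(p+1). (Equivalently, the rank of the Cartier operator on the Hurwitz curve H_{sp+1} is s(s+1)p(p+1)/4.) -/
/-- For `n = s * p + 1`, the pair `(i, j)` is Hurwitz-admissible exactly when adding the residues
of `i` and `j` modulo `p` produces no carry. -/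
theorem hurwitzAdmissible_mul_add_one_iff {p : ℕ} (hp : 0 < p) (s i j : ℕ) :
    HurwitzAdmissible (s * p + 1) p i j ↔ i % p + j % p < p := by
  have hi := Nat.mod_add_div i p
  have hj := Nat.mod_add_div j p
  have hip := Nat.mod_lt i hp
  have hjp := Nat.mod_lt j hp
  constructor
  · rintro ⟨h, k, hh, hk, h₁, h₂⟩
    by_contra! hlt
    obtain ⟨c, hc⟩ := h₁.dvd
    obtain ⟨d, hd⟩ := h₂.dvd
    have e₁ : (p : ℤ) ∣ (k : ℤ) - h + (i % p : ℕ) := by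
      refine ⟨-c - s * k - (i / p : ℕ), ?_⟩
      zify at hi
      push_cast at hc hi ⊢
      linear_combination -hc + hi
    have e₂ : (p : ℤ) ∣ (h : ℤ) + (j % p : ℕ) + 1 - p := by
      refine ⟨-d - s * (h - k) - (j / p : ℕ), ?_⟩
      zify at hj
      push_cast at hd hj ⊢
      linear_combination -hd + hj
    have z₂ := Int.eq_zero_of_abs_lt_dvd e₂ (by rw [abs_lt]; omega)
    have z₁ := Int.eq_zero_of_abs_lt_dvd e₁ (by rw [abs_lt]; omega)
    omega
  · intro hlt
    refine ⟨p - 1 - j % p, p - 1 - j % p - i % p, by omega, by omega, ?_, ?_⟩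
    · apply Int.ModEq.symm
      rw [Int.modEq_iff_dvd]
      refine ⟨s * (p - 1 - j % p - i % p : ℕ) + (i / p : ℕ), ?_⟩
      have hk : ((p - 1 - j % p - i % p : ℕ) : ℤ) = (p - 1 - j % p : ℕ) - (i % p : ℕ) := by omega
      zify at hi
      push_cast at hi hk ⊢
      linear_combination hk - hi
    · apply Int.ModEq.symm
      rw [Int.modEq_iff_dvd]
      refine ⟨s * ((p - 1 - j % p : ℕ) - (p - 1 - j % p - i % p : ℕ)) + (j / p : ℕ), ?_⟩
      have hh : ((p - 1 - j % p : ℕ) : ℤ) = p - 1 - (j % p : ℕ) := by omega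
      zify at hj
      push_cast at hj hh ⊢
      linear_combination hh - hj

/-- The pairs of natural numbers with sum less than `m`. -/
def sumLtFinset (m : ℕ) : Finset (ℕ × ℕ) :=
  (Finset.range m).biUnion Finset.HasAntidiagonal.antidiagonal

theorem mem_sumLtFinset {m : ℕ} {x : ℕ × ℕ} : x ∈ sumLtFinset m ↔ x.1 + x.2 < m := by
  simp [sumLtFinset]

theorem two_mul_card_sumLtFinset (m : ℕ) : 2 * (sumLtFinset m).card = m * (m + 1) := by
  rw [sumLtFinset, Finset.card_biUnion]
  · induction m with
    | zero => simp
    | succ m ih =>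
      rw [Finset.sum_range_succ, mul_add, ih, Finset.Nat.card_antidiagonal]
      ring
  · intro a _ b _ hab
    rw [Function.onFun, Finset.disjoint_left]
    intro x ha hb
    rw [Finset.HasAntidiagonal.mem_antidiagonal] at ha hb
    exact hab (ha.symm.trans hb)

theorem add_lt_mul_iff_div_add_div_lt {p i j : ℕ} (s : ℕ) (h : i % p + j % p < p) :
    i + j < s * p ↔ i / p + j / p < s := by
  rw [← Nat.div_lt_iff_lt_mul (by omega), Nat.add_div (by omega), if_neg (by omega), add_zero]

/-- The rank of the Cartier operator on the Hurwitz curve `H_{sp+1}` is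
`s*(s+1)*p*(p+1)/4`. -/
theorem four_mul_card_hurwitzAdmissible_sp_add_one
    (p s n : ℕ) (hp : p.Prime) (hs : 1 ≤ s) (hn : n = s * p + 1) :
    4 * {ij : ℕ × ℕ | ij.1 + ij.2 ≤ n - 2 ∧
          HurwitzAdmissible n p ij.1 ij.2}.ncard
      = s * (s + 1) * p * (p + 1) := by
  subst hn
  have hp0 := hp.pos
  have hsp : 0 < s * p := Nat.mul_pos hs hp0
  have hcard : {ij : ℕ × ℕ | ij.1 + ij.2 ≤ s * p + 1 - 2 ∧
      HurwitzAdmissible (s * p + 1) p ij.1 ij.2}.ncard =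
      (sumLtFinset s ×ˢ sumLtFinset p).card := by
    rw [← Set.ncard_coe_finset]
    refine Set.ncard_congr
      (fun x _ => ((x.1 / p, x.2 / p), (x.1 % p, x.2 % p))) ?_ ?_ ?_
    · rintro ⟨i, j⟩ ⟨hle, hadm⟩
      rw [hurwitzAdmissible_mul_add_one_iff hp0] at hadm
      have := (add_lt_mul_iff_div_add_div_lt s hadm).1 (by change i + j ≤ _ at hle; omega)
      simpa [mem_sumLtFinset] using And.intro this hadm
    · rintro ⟨i, j⟩ ⟨i', j'⟩ _ _ h
      simp only [Prod.mk.injEq] at h ⊢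
      obtain ⟨⟨hi, hj⟩, hi', hj'⟩ := h
      rw [← Nat.mod_add_div i p, ← Nat.mod_add_div j p, hi, hj, hi', hj']
      exact ⟨Nat.mod_add_div _ _, Nat.mod_add_div _ _⟩
    · rintro ⟨⟨a, b⟩, ⟨c, d⟩⟩ h
      simp only [Finset.mem_coe, Finset.mem_product, mem_sumLtFinset] at h
      obtain ⟨hab, hcd⟩ := h
      have hc : c < p := by omega
      have hd : d < p := by omega
      have hcm : (c + p * a) % p = c := by rw [Nat.add_mul_mod_self_left, Nat.mod_eq_of_lt hc]
      have hdm : (d + p * b) % p = d := by rw [Nat.add_mul_mod_self_left, Nat.mod_eq_of_lt hd]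
      have hcq : (c + p * a) / p = a := by
        rw [Nat.add_mul_div_left _ _ hp0, Nat.div_eq_of_lt hc, zero_add]
      have hdq : (d + p * b) / p = b := by
        rw [Nat.add_mul_div_left _ _ hp0, Nat.div_eq_of_lt hd, zero_add]
      have hadm : (c + p * a) % p + (d + p * b) % p < p := by rwa [hcm, hdm]
      have hlt := (add_lt_mul_iff_div_add_div_lt s hadm).2 (by rwa [hcq, hdq])
      refine ⟨(c + p * a, d + p * b),
        ⟨?_, (hurwitzAdmissible_mul_add_one_iff hp0 s _ _).2 hadm⟩, ?_⟩
      · dsimp only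
        omega
      · simp only [hcm, hdm, hcq, hdq]
  rw [hcard, Finset.card_product]
  calc 4 * ((sumLtFinset s).card * (sumLtFinset p).card)
      = (2 * (sumLtFinset s).card) * (2 * (sumLtFinset p).card) := by ring
    _ = s * (s + 1) * p * (p + 1) := by
      rw [two_mul_card_sumLtFinset, two_mul_card_sumLtFinset]
      ring
end

section
/- Let p be a prime and set n = p+1. Then every pair (i,j) of nonnegative integers with i+j ≤ p−1 is Hurwitz-admissible for n and p; consequently the number of Hurwitz-admissible pairs equals p(p+1)/2, the full genus of H_{p+1}. (Equivalently, the rank of the Cartier operator on the Hurwitz curve H_{p+1} equals its genus p(p+1)/2.) -/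
/-- The pairs `(i, j)` with `i + j < p` number `1 + 2 + ⋯ + p`. -/
theorem two_mul_ncard_add_lt (p : ℕ) :
    2 * {ij : ℕ × ℕ | ij.1 + ij.2 < p}.ncard = p * (p + 1) := by
  have hset : {ij : ℕ × ℕ | ij.1 + ij.2 < p} =
      ((Finset.range p).biUnion Finset.HasAntidiagonal.antidiagonal : Finset (ℕ × ℕ)) := by
    ext ⟨i, j⟩
    simp
  rw [hset, Set.ncard_coe_finset, Finset.card_biUnion]
  · simp only [Finset.Nat.card_antidiagonal]
    clear hset
    induction p with
    | zero => simp
    | succ p ih => rw [Finset.sum_range_succ, mul_add, ih]; ring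
  · intro a _ b _ hab
    rw [Function.onFun, Finset.disjoint_left]
    intro x hxa hxb
    rw [Finset.HasAntidiagonal.mem_antidiagonal] at hxa hxb
    exact hab (hxa.symm.trans hxb)

/-- The witnesses are `h = p - 1 - j` and `k = p - 1 - j - i`. -/
theorem HurwitzAdmissible.of_add_lt {p i j : ℕ} (hij : i + j < p) :
    HurwitzAdmissible (p + 1) p i j := by
  obtain ⟨k, rfl⟩ : ∃ k, p = i + j + k + 1 := ⟨p - 1 - (i + j), by omega⟩
  refine ⟨k + i, k, by omega, by omega, ?_, ?_⟩
  · refine Int.modEq_zero_iff_dvd.2 ⟨k, ?_⟩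
    push_cast
    ring
  · refine Int.modEq_iff_dvd.2 ⟨-i, ?_⟩
    push_cast
    ring

/-- For `n = p + 1`, every pair `(i, j)` with `i + j ≤ p - 1` is Hurwitz-admissible,
and the number of Hurwitz-admissible pairs equals `p*(p+1)/2`, the full genus of
`H_{p+1}`. -/
theorem hurwitzAdmissible_p_add_one (p : ℕ) (hp : p.Prime) :
    (∀ i j : ℕ, i + j ≤ p - 1 → HurwitzAdmissible (p + 1) p i j) ∧
    2 * {ij : ℕ × ℕ | ij.1 + ij.2 ≤ p - 1 ∧
          HurwitzAdmissible (p + 1) p ij.1 ij.2}.ncard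
      = p * (p + 1) := by
  have hlt (i j : ℕ) : i + j ≤ p - 1 ↔ i + j < p := by
    have := hp.pos
    omega
  refine ⟨fun i j hij => .of_add_lt ((hlt i j).1 hij), ?_⟩
  rw [← two_mul_ncard_add_lt p]
  congr 2
  ext ⟨i, j⟩
  simp only [Set.mem_ofPred_eq, hlt]
  exact ⟨fun h => h.1, fun h => ⟨h, .of_add_lt h⟩⟩
end
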